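/- arXiv:1109.3771 — 2 statements merged into one kernel-verified Lean document; each statement's English description precedes it below -/
import Mathlib

section
/- Fix integers d ≥ p ≥ 2 and define δ : ℕ → ℕ by δ(n) = (n−r)d/p + r where r ∈ {0, 1, …, p−1} and n ≡ r (mod p). Let R be an augmented Noetherian semiperfect algebra with Jacobson radical J and let ξ : 0 → K → M → N → 0 be a short exact sequence of finitely generated R-modules in which K, M and N are all quasi-δ-Koszul modules (quasi-piecewise-Koszul modules). Then J·K = K ∩ J·M (identifying K with its image in M) if and only if the minimal Horseshoe Lemma holds for ξ. -/
/-- `jSMul I K` is the submodule `I·K` generated by the products `r • k`,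
`r ∈ I`, `k ∈ K`. -/
def jSMul {R : Type} [Ring R] {M : Type} [AddCommGroup M] [Module R M]
    (I : Ideal R) (K : Submodule R M) : Submodule R M :=
  Submodule.span R {x : M | ∃ r ∈ I, ∃ k ∈ K, x = r • k}

/-- `jPowSMul I n K` is the submodule `Iⁿ·K`. -/
def jPowSMul {R : Type} [Ring R] {M : Type} [AddCommGroup M] [Module R M]
    (I : Ideal R) : ℕ → Submodule R M → Submodule R M
  | 0, K => K
  | n + 1, K => jSMul I (jPowSMul I n K)

/-- The Jacobson radical of a ring. -/
abbrev jacobsonRad (R : Type) [Ring R] : Ideal R := Ideal.jacobson (⊥ : Ideal R)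

/-- A minimal projective resolution `⋯ → P₁ → P₀ → X → 0`. -/
structure MinProjRes (R : Type) [Ring R] (J : Ideal R)
    (X : Type) [AddCommGroup X] [Module R X] where
  obj : ℕ → Type
  [addcomm : ∀ n, AddCommGroup (obj n)]
  [mod : ∀ n, Module R (obj n)]
  proj : ∀ n, Module.Projective R (obj n)
  fin : ∀ n, Module.Finite R (obj n)
  d : ∀ n, obj (n + 1) →ₗ[R] obj n
  aug : obj 0 →ₗ[R] X
  aug_surj : Function.Surjective aug
  exact0 : LinearMap.range (d 0) = LinearMap.ker aug
  exact : ∀ n, LinearMap.range (d (n + 1)) = LinearMap.ker (d n)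
  minimal0 : LinearMap.ker aug ≤ jSMul J ⊤
  minimal : ∀ n, LinearMap.ker (d n) ≤ jSMul J ⊤

attribute [instance] MinProjRes.addcomm MinProjRes.mod

/-- The syzygies of a minimal projective resolution: `P.syz n ⊆ Pₙ`
is the `(n+1)`-st syzygy `Ω^{n+1}(X) = ker dₙ`. -/
def MinProjRes.syz {R : Type} [Ring R] {J : Ideal R}
    {X : Type} [AddCommGroup X] [Module R X]
    (P : MinProjRes R J X) : ∀ n, Submodule R (P.obj n)
  | 0 => LinearMap.ker P.aug
  | n + 1 => LinearMap.ker (P.d n)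

/-- A projective cover of a finitely generated module. -/
structure ProjCover (R : Type) [Ring R] (J : Ideal R)
    (X : Type) [AddCommGroup X] [Module R X] where
  P : Type
  [addcomm : AddCommGroup P]
  [mod : Module R P]
  p : P →ₗ[R] X
  proj : Module.Projective R P
  fin : Module.Finite R P
  surj : Function.Surjective p
  ker_le : LinearMap.ker p ≤ jSMul J ⊤

attribute [instance] ProjCover.addcomm ProjCover.mod

/-- `R` is semiperfect: every finitely generated module has a projective cover. -/
def Semiperfect (R : Type) [Ring R] : Prop :=
  ∀ (X : Type) [AddCommGroup X] [Module R X], Module.Finite R X →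
    Nonempty (ProjCover R (jacobsonRad R) X)

/-- The minimal Horseshoe Lemma holds for the short exact sequence
`0 → K →f→ M →g→ N → 0`. -/
def MinimalHorseshoe {R : Type} [Ring R] (J : Ideal R)
    {K M N : Type} [AddCommGroup K] [Module R K] [AddCommGroup M] [Module R M]
    [AddCommGroup N] [Module R N] (f : K →ₗ[R] M) (g : M →ₗ[R] N) : Prop :=
  ∃ (P : MinProjRes R J K) (L : MinProjRes R J M) (Q : MinProjRes R J N)
    (φ : ∀ n, P.obj n →ₗ[R] L.obj n) (ψ : ∀ n, L.obj n →ₗ[R] Q.obj n),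
    L.aug ∘ₗ φ 0 = f ∘ₗ P.aug ∧
    Q.aug ∘ₗ ψ 0 = g ∘ₗ L.aug ∧
    (∀ n, L.d n ∘ₗ φ (n + 1) = φ n ∘ₗ P.d n) ∧
    (∀ n, Q.d n ∘ₗ ψ (n + 1) = ψ n ∘ₗ L.d n) ∧
    (∀ n, Function.Injective (φ n)) ∧
    (∀ n, Function.Surjective (ψ n)) ∧
    (∀ n, LinearMap.ker (ψ n) = LinearMap.range (φ n))

/-- `X` is a quasi-`δ`-Koszul module. -/
def IsQuasiDeltaKoszul {R : Type} [Ring R] (J : Ideal R) (δ : ℕ → ℕ)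
    (X : Type) [AddCommGroup X] [Module R X] : Prop :=
  ∃ P : MinProjRes R J X, ∀ n,
    P.syz n ≤ jPowSMul J (δ (n + 1) - δ n) ⊤ ∧
    jSMul J (P.syz n) = P.syz n ⊓ jPowSMul J (δ (n + 1) - δ n + 1) ⊤

/-- `X` is a quasi-Koszul module. -/
def IsQuasiKoszul {R : Type} [Ring R] (J : Ideal R)
    (X : Type) [AddCommGroup X] [Module R X] : Prop :=
  ∃ P : MinProjRes R J X, ∀ n,
    jSMul J (P.syz n) = P.syz n ⊓ jPowSMul J 2 ⊤

theorem jSMul_eq_smul {R : Type} [Ring R] {M : Type} [AddCommGroup M] [Module R M]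
    (I : Ideal R) (K : Submodule R M) : jSMul I K = I • K := by
  refine le_antisymm (Submodule.span_le.2 ?_) (Submodule.smul_le.2 fun r hr k hk =>
    Submodule.subset_span ⟨r, hr, k, hk, rfl⟩)
  rintro _ ⟨r, hr, k, hk, rfl⟩
  exact Submodule.smul_mem_smul hr hk

theorem jPowSMul_mono {R : Type} [Ring R] {M : Type} [AddCommGroup M] [Module R M]
    (I : Ideal R) (n : ℕ) {K K' : Submodule R M} (h : K ≤ K') :
    jPowSMul I n K ≤ jPowSMul I n K' := by
  induction n with
  | zero => exact h
  | succ n ih =>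
    simp only [jPowSMul, jSMul_eq_smul]
    exact Submodule.smul_mono le_rfl ih

theorem map_jPowSMul {R : Type} [Ring R] {M N : Type} [AddCommGroup M] [Module R M]
    [AddCommGroup N] [Module R N] (I : Ideal R) (n : ℕ) (h : M →ₗ[R] N) (K : Submodule R M) :
    (jPowSMul I n K).map h = jPowSMul I n (K.map h) := by
  induction n with
  | zero => rfl
  | succ n ih => simp only [jPowSMul, jSMul_eq_smul, Submodule.map_smul'', ih]

theorem map_mem_jPowSMul_top {R : Type} [Ring R] {M N : Type} [AddCommGroup M] [Module R M]
    [AddCommGroup N] [Module R N] (I : Ideal R) (n : ℕ) (h : M →ₗ[R] N) {x : M}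
    (hx : x ∈ jPowSMul I n (⊤ : Submodule R M)) : h x ∈ jPowSMul I n (⊤ : Submodule R N) :=
  jPowSMul_mono I n le_top (map_jPowSMul I n h ⊤ ▸ Submodule.mem_map_of_mem hx)

theorem map_mem_smul_top {R : Type} [Ring R] {M N : Type} [AddCommGroup M] [Module R M]
    [AddCommGroup N] [Module R N] (I : Ideal R) (h : M →ₗ[R] N) {x : M}
    (hx : x ∈ I • (⊤ : Submodule R M)) : h x ∈ I • (⊤ : Submodule R N) :=
  Submodule.smul_mono le_rfl le_top
    (Submodule.map_smul'' I ⊤ h ▸ Submodule.mem_map_of_mem hx)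

theorem exists_mem_smul_top_of_surjective {R : Type} [Ring R] {M N : Type} [AddCommGroup M]
    [Module R M] [AddCommGroup N] [Module R N] (I : Ideal R) {h : M →ₗ[R] N}
    (hh : Function.Surjective h) {y : N} (hy : y ∈ I • (⊤ : Submodule R N)) :
    ∃ x ∈ I • (⊤ : Submodule R M), h x = y := by
  rw [← LinearMap.range_eq_top.2 hh, LinearMap.range_eq_map, ← Submodule.map_smul''] at hy
  exact hy

theorem mem_smul_iff_coe_mem {R : Type} [Ring R] {M : Type} [AddCommGroup M] [Module R M]
    (I : Ideal R) (S : Submodule R M) (x : S) :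
    x ∈ I • (⊤ : Submodule R S) ↔ (x : M) ∈ I • S := by
  have h : (I • (⊤ : Submodule R S)).map S.subtype = I • S := by
    rw [Submodule.map_smul'', Submodule.map_subtype_top]
  rw [← h]
  exact ⟨fun hx => ⟨x, hx, rfl⟩, fun ⟨y, hy, hyx⟩ => Subtype.ext hyx ▸ hy⟩

/-- Nakayama's lemma over a noncommutative ring. -/
theorem eq_top_of_forall_sub_mem {R : Type} [Ring R] {M : Type} [AddCommGroup M] [Module R M]
    [Module.Finite R M] (S : Submodule R M)
    (h : ∀ x : M, ∃ y ∈ S, x - y ∈ jacobsonRad R • (⊤ : Submodule R M)) : S = ⊤ := by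
  have key : (⊤ : Submodule R (M ⧸ S)) = ⊥ := by
    refine Submodule.FG.eq_bot_of_le_jacobson_smul Module.Finite.fg_top fun x _ => ?_
    obtain ⟨x, rfl⟩ := S.mkQ_surjective x
    obtain ⟨y, hy, hxy⟩ := h x
    have h' := map_mem_smul_top _ S.mkQ hxy
    rw [map_sub, show S.mkQ y = 0 from (Submodule.Quotient.mk_eq_zero S).2 hy, sub_zero] at h'
    rwa [← Ideal.jacobson_bot]
  rw [← S.ker_mkQ, LinearMap.ker_eq_top]
  ext x
  have : S.mkQ x ∈ (⊥ : Submodule R (M ⧸ S)) := key ▸ Submodule.mem_top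
  simpa using this

/-- A short exact sequence `0 → K → M → N → 0` with `J·K = K ∩ J·M` lifts to a split short exact
sequence between given projective covers of its terms. -/
theorem exists_split_lift_of_projCovers {R : Type} [Ring R] {J : Ideal R} (hJ : J = jacobsonRad R)
    {K M N P L Q : Type} [AddCommGroup K] [Module R K] [AddCommGroup M] [Module R M]
    [AddCommGroup N] [Module R N] [AddCommGroup P] [Module R P] [AddCommGroup L] [Module R L]
    [AddCommGroup Q] [Module R Q] [Module.Projective R P] [Module.Projective R L]
    [Module.Projective R Q] [Module.Finite R P] [Module.Finite R L] [Module.Finite R Q]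
    {f : K →ₗ[R] M} {g : M →ₗ[R] N} (hg : Function.Surjective g)
    (hfg : LinearMap.range f = LinearMap.ker g)
    (hpure : ∀ x, f x ∈ J • (⊤ : Submodule R M) → x ∈ J • (⊤ : Submodule R K))
    {a : P →ₗ[R] K} {b : L →ₗ[R] M} {c : Q →ₗ[R] N} (ha : Function.Surjective a)
    (hb : Function.Surjective b) (hc : Function.Surjective c)
    (ha' : LinearMap.ker a ≤ J • ⊤) (hb' : LinearMap.ker b ≤ J • ⊤)
    (hc' : LinearMap.ker c ≤ J • ⊤) :
    ∃ (φ : P →ₗ[R] L) (ψ : L →ₗ[R] Q) (ρ : L →ₗ[R] P),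
      b ∘ₗ φ = f ∘ₗ a ∧ c ∘ₗ ψ = g ∘ₗ b ∧ ρ ∘ₗ φ = LinearMap.id ∧
      Function.Surjective ψ ∧ LinearMap.ker ψ = LinearMap.range φ := by
  have gf : ∀ x, g (f x) = 0 := fun x =>
    LinearMap.mem_ker.1 (hfg ▸ LinearMap.mem_range_self f x)
  obtain ⟨φ, hφ⟩ := Module.projective_lifting_property b (f ∘ₗ a) hb
  obtain ⟨t, ht⟩ := Module.projective_lifting_property (g ∘ₗ b) c (hg.comp hb)
  replace hφ : ∀ x, b (φ x) = f (a x) := fun x => LinearMap.congr_fun hφ x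
  replace ht : ∀ x, g (b (t x)) = c x := fun x => LinearMap.congr_fun ht x
  let θ : P × Q →ₗ[R] L := φ.coprod t
  have θ_apply : ∀ w z, θ (w, z) = φ w + t z := fun w z => by simp [θ]
  have hθ_surj : Function.Surjective θ := by
    rw [← LinearMap.range_eq_top]
    refine eq_top_of_forall_sub_mem _ fun y => ?_
    obtain ⟨z, hz⟩ := hc (g (b y))
    have : b (y - t z) ∈ LinearMap.range f := by
      rw [hfg, LinearMap.mem_ker, map_sub, map_sub, ht, hz, sub_self]
    obtain ⟨x, hx⟩ := this
    obtain ⟨w, rfl⟩ := ha x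
    refine ⟨θ (w, z), LinearMap.mem_range_self _ _, hJ ▸ hb' ?_⟩
    rw [LinearMap.mem_ker, θ_apply, map_sub, map_add, hφ, hx, map_sub]
    abel
  have hθ_ker : LinearMap.ker θ ≤ J • ⊤ := by
    rintro ⟨w, z⟩ h
    rw [LinearMap.mem_ker, θ_apply] at h
    have hz : z ∈ J • (⊤ : Submodule R Q) := by
      apply hc'
      have := congrArg (fun y => g (b y)) h
      simpa [hφ, gf, ht] using this
    have hφw : φ w ∈ J • (⊤ : Submodule R L) := by
      rw [eq_neg_of_add_eq_zero_left h]
      exact neg_mem (map_mem_smul_top J t hz)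
    have haw : a w ∈ J • (⊤ : Submodule R K) :=
      hpure _ (hφ w ▸ map_mem_smul_top J b hφw)
    obtain ⟨w', hw', hww'⟩ := exists_mem_smul_top_of_surjective J ha haw
    have hw : w ∈ J • (⊤ : Submodule R P) := by
      have : w - w' ∈ J • (⊤ : Submodule R P) := ha' (by simp [hww'])
      simpa using add_mem this hw'
    have := add_mem (map_mem_smul_top J (LinearMap.inl R P Q) hw)
      (map_mem_smul_top J (LinearMap.inr R P Q) hz)
    simpa using this
  obtain ⟨σ, hσ⟩ := Module.projective_lifting_property θ LinearMap.id hθ_surj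
  replace hσ : ∀ y, θ (σ y) = y := fun y => LinearMap.congr_fun hσ y
  have hσ_surj : Function.Surjective σ := by
    rw [← LinearMap.range_eq_top]
    refine eq_top_of_forall_sub_mem _ fun x => ⟨σ (θ x), LinearMap.mem_range_self _ _, hJ ▸ hθ_ker ?_⟩
    simp [hσ]
  have hσθ : ∀ x, σ (θ x) = x := fun x => by
    obtain ⟨y, rfl⟩ := hσ_surj x
    rw [hσ]
  have hσφ : ∀ w, σ (φ w) = (w, 0) := fun w => by
    rw [← hσθ (w, 0), θ_apply, map_zero, add_zero]
  refine ⟨φ, LinearMap.snd R P Q ∘ₗ σ, LinearMap.fst R P Q ∘ₗ σ, LinearMap.ext hφ,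
    LinearMap.ext fun y => ?_, LinearMap.ext fun w => ?_, Prod.snd_surjective.comp hσ_surj, ?_⟩
  · obtain ⟨⟨w, z⟩, rfl⟩ := hθ_surj y
    simp only [LinearMap.comp_apply, hσθ, LinearMap.snd_apply]
    rw [θ_apply, map_add, map_add, hφ, gf, ht, zero_add]
  · simp [hσφ]
  · ext y
    constructor
    · intro h
      refine ⟨(σ y).1, ?_⟩
      have h2 : (σ y).2 = 0 := h
      have := hσ y
      rw [← Prod.mk.eta (p := σ y), θ_apply, h2, map_zero, add_zero] at this
      exact this
    · rintro ⟨w, rfl⟩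
      simp [hσφ]

/-- Surjectivity of `ker b → ker c` in a lift of a short exact sequence to covers. -/
theorem exists_mem_ker_of_lift {R : Type} [Ring R]
    {K M N P L Q : Type} [AddCommGroup K] [Module R K] [AddCommGroup M] [Module R M]
    [AddCommGroup N] [Module R N] [AddCommGroup P] [Module R P] [AddCommGroup L] [Module R L]
    [AddCommGroup Q] [Module R Q] {f : K →ₗ[R] M} {g : M →ₗ[R] N}
    (hfg : LinearMap.range f = LinearMap.ker g)
    {a : P →ₗ[R] K} {b : L →ₗ[R] M} {c : Q →ₗ[R] N} (ha : Function.Surjective a)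
    {φ : P →ₗ[R] L} {ψ : L →ₗ[R] Q} (h₁ : b ∘ₗ φ = f ∘ₗ a) (h₂ : c ∘ₗ ψ = g ∘ₗ b)
    (hψ : Function.Surjective ψ) (hker : LinearMap.ker ψ = LinearMap.range φ)
    {z : Q} (hz : c z = 0) : ∃ y, b y = 0 ∧ ψ y = z := by
  obtain ⟨y, rfl⟩ := hψ z
  have : b y ∈ LinearMap.range f := by
    rw [hfg, LinearMap.mem_ker]
    exact (LinearMap.congr_fun h₂ y).symm.trans hz
  obtain ⟨x, hx⟩ := this
  obtain ⟨w, rfl⟩ := ha x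
  have hw : b (φ w) = f (a w) := LinearMap.congr_fun h₁ w
  have hψw : ψ (φ w) = 0 := LinearMap.mem_ker.1 (hker ▸ LinearMap.mem_range_self φ w)
  exact ⟨y - φ w, by rw [map_sub, hw, hx, sub_self], by rw [map_sub, hψw, sub_zero]⟩

theorem MinProjRes.range_d {R : Type} [Ring R] {J : Ideal R} {X : Type} [AddCommGroup X]
    [Module R X] (P : MinProjRes R J X) : ∀ n, LinearMap.range (P.d n) = P.syz n
  | 0 => P.exact0
  | n + 1 => P.exact n

/-- The cover of the `(n+1)`-st syzygy by the next term of the resolution. -/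
def MinProjRes.toSyz {R : Type} [Ring R] {J : Ideal R} {X : Type} [AddCommGroup X]
    [Module R X] (P : MinProjRes R J X) (n : ℕ) : P.obj (n + 1) →ₗ[R] P.syz n :=
  (P.d n).codRestrict (P.syz n) fun x => P.range_d n ▸ LinearMap.mem_range_self _ x

theorem MinProjRes.toSyz_surjective {R : Type} [Ring R] {J : Ideal R} {X : Type} [AddCommGroup X]
    [Module R X] (P : MinProjRes R J X) (n : ℕ) : Function.Surjective (P.toSyz n) := by
  rintro ⟨x, hx⟩
  obtain ⟨y, rfl⟩ := (P.range_d n).ge hx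
  exact ⟨y, rfl⟩

theorem MinProjRes.ker_toSyz {R : Type} [Ring R] {J : Ideal R} {X : Type} [AddCommGroup X]
    [Module R X] (P : MinProjRes R J X) (n : ℕ) :
    LinearMap.ker (P.toSyz n) = LinearMap.ker (P.d n) :=
  LinearMap.ker_codRestrict _ _ _

/-- A short exact sequence between the `n`-th terms of three resolutions which restricts to a
short exact sequence `0 → S → T → U → 0` of syzygies with `J·S = S ∩ J·T`. -/
structure SyzygyExact {R : Type} [Ring R] {J : Ideal R} {K M N : Type} [AddCommGroup K]
    [Module R K] [AddCommGroup M] [Module R M] [AddCommGroup N] [Module R N]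
    (P : MinProjRes R J K) (L : MinProjRes R J M) (Q : MinProjRes R J N) (n : ℕ)
    (φ : P.obj n →ₗ[R] L.obj n) (ψ : L.obj n →ₗ[R] Q.obj n) : Prop where
  injective : Function.Injective φ
  surjective : Function.Surjective ψ
  exact : LinearMap.ker ψ = LinearMap.range φ
  map_mem : ∀ x ∈ P.syz n, φ x ∈ L.syz n
  map_mem' : ∀ y ∈ L.syz n, ψ y ∈ Q.syz n
  mem_of_map_mem : ∀ x, φ x ∈ L.syz n → x ∈ P.syz n
  exists_mem : ∀ z ∈ Q.syz n, ∃ y ∈ L.syz n, ψ y = z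
  pure : ∀ x ∈ P.syz n, φ x ∈ J • L.syz n → x ∈ J • P.syz n

/-- Lifting a short exact sequence to projective covers preserves the purity condition on
kernels, when these kernels lie in `Jᵐ` and satisfy `J·ker = ker ∩ Jᵐ⁺¹` on the left. -/
theorem mem_smul_ker_of_lift {R : Type} [Ring R] {J : Ideal R} {P L : Type} [AddCommGroup P]
    [Module R P] [AddCommGroup L] [Module R L] {φ : P →ₗ[R] L} {ρ : L →ₗ[R] P}
    (h : ρ ∘ₗ φ = LinearMap.id) {S : Submodule R P} {T : Submodule R L} {m : ℕ}
    (hS : jSMul J S = S ⊓ jPowSMul J (m + 1) ⊤) (hT : T ≤ jPowSMul J m ⊤)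
    {x : P} (hx : x ∈ S) (hφx : φ x ∈ J • T) : x ∈ J • S := by
  rw [← jSMul_eq_smul, hS]
  refine ⟨hx, ?_⟩
  have h' : φ x ∈ jPowSMul J (m + 1) ⊤ := by
    rw [jPowSMul, jSMul_eq_smul]
    exact Submodule.smul_mono le_rfl hT hφx
  have := map_mem_jPowSMul_top J (m + 1) ρ h'
  rwa [show ρ (φ x) = x from LinearMap.congr_fun h x] at this

section Lifting

variable {R : Type} [Ring R] {J : Ideal R} {K M N : Type} [AddCommGroup K]
  [Module R K] [AddCommGroup M] [Module R M] [AddCommGroup N] [Module R N]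
  {P : MinProjRes R J K} {L : MinProjRes R J M} {Q : MinProjRes R J N}

/-- Lifting a pure short exact sequence along surjections with the given syzygies as kernels. -/
theorem exists_syzygyExact_of_covers (hJ : J = jacobsonRad R) {m : ℕ} (n : ℕ)
    (hP : jSMul J (P.syz n) = P.syz n ⊓ jPowSMul J (m + 1) ⊤)
    (hL : L.syz n ≤ jPowSMul J m ⊤)
    (hPJ : P.syz n ≤ J • ⊤) (hLJ : L.syz n ≤ J • ⊤) (hQJ : Q.syz n ≤ J • ⊤)
    {A B C : Type} [AddCommGroup A] [Module R A] [AddCommGroup B] [Module R B]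
    [AddCommGroup C] [Module R C] {f : A →ₗ[R] B} {g : B →ₗ[R] C} (hf : Function.Injective f)
    (hg : Function.Surjective g) (hfg : LinearMap.range f = LinearMap.ker g)
    (hpure : ∀ x, f x ∈ J • (⊤ : Submodule R B) → x ∈ J • (⊤ : Submodule R A))
    {a : P.obj n →ₗ[R] A} {b : L.obj n →ₗ[R] B} {c : Q.obj n →ₗ[R] C}
    (ha : Function.Surjective a) (hb : Function.Surjective b) (hc : Function.Surjective c)
    (ha' : LinearMap.ker a = P.syz n) (hb' : LinearMap.ker b = L.syz n)
    (hc' : LinearMap.ker c = Q.syz n) :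
    ∃ φ ψ, SyzygyExact P L Q n φ ψ ∧ b ∘ₗ φ = f ∘ₗ a ∧ c ∘ₗ ψ = g ∘ₗ b := by
  have := P.proj n
  have := L.proj n
  have := Q.proj n
  have := P.fin n
  have := L.fin n
  have := Q.fin n
  obtain ⟨φ, ψ, ρ, h₁, h₂, hρ, hψ, hker⟩ := exists_split_lift_of_projCovers hJ hg hfg hpure
    ha hb hc (ha'.trans_le hPJ) (hb'.trans_le hLJ) (hc'.trans_le hQJ)
  have h₁' : ∀ x, b (φ x) = f (a x) := fun x => LinearMap.congr_fun h₁ x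
  have h₂' : ∀ y, c (ψ y) = g (b y) := fun y => LinearMap.congr_fun h₂ y
  refine ⟨φ, ψ, ⟨?_, hψ, hker, fun x hx => ?_, fun y hy => ?_, fun x hx => ?_, fun z hz => ?_,
    fun x hx => mem_smul_ker_of_lift hρ hP hL hx⟩, h₁, h₂⟩
  · exact Function.LeftInverse.injective (g := ρ) fun x => LinearMap.congr_fun hρ x
  · rw [← ha', LinearMap.mem_ker] at hx
    rw [← hb', LinearMap.mem_ker, h₁', hx, map_zero]
  · rw [← hb', LinearMap.mem_ker] at hy
    rw [← hc', LinearMap.mem_ker, h₂', hy, map_zero]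
  · rw [← hb', LinearMap.mem_ker, h₁'] at hx
    rw [← ha', LinearMap.mem_ker]
    exact hf (hx.trans (map_zero f).symm)
  · rw [← hc', LinearMap.mem_ker] at hz
    rw [← hb']
    exact exists_mem_ker_of_lift hfg ha h₁ h₂ hψ hker hz

theorem SyzygyExact.exists_succ (hJ : J = jacobsonRad R) {m : ℕ} {n : ℕ}
    (hP : jSMul J (P.syz (n + 1)) = P.syz (n + 1) ⊓ jPowSMul J (m + 1) ⊤)
    (hL : L.syz (n + 1) ≤ jPowSMul J m ⊤)
    {φ : P.obj n →ₗ[R] L.obj n} {ψ : L.obj n →ₗ[R] Q.obj n} (h : SyzygyExact P L Q n φ ψ) :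
    ∃ φ' ψ', SyzygyExact P L Q (n + 1) φ' ψ' ∧ L.d n ∘ₗ φ' = φ ∘ₗ P.d n ∧
      Q.d n ∘ₗ ψ' = ψ ∘ₗ L.d n := by
  obtain ⟨φ', ψ', h', h₁, h₂⟩ := exists_syzygyExact_of_covers (P := P) (L := L) (Q := Q)
    hJ (n + 1) hP hL
    ((P.minimal n).trans_eq (jSMul_eq_smul _ _)) ((L.minimal n).trans_eq (jSMul_eq_smul _ _))
    ((Q.minimal n).trans_eq (jSMul_eq_smul _ _))
    (f := φ.restrict h.map_mem) (g := ψ.restrict h.map_mem')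
    (fun x y hxy => Subtype.ext (h.injective (congrArg Subtype.val hxy)))
    (fun z => by
      obtain ⟨y, hy, hyz⟩ := h.exists_mem z z.2
      exact ⟨⟨y, hy⟩, Subtype.ext hyz⟩)
    (by
      ext y
      constructor
      · rintro ⟨x, rfl⟩
        exact Subtype.ext (LinearMap.mem_ker.1 (h.exact.ge (LinearMap.mem_range_self φ x)))
      · intro hy
        obtain ⟨x, hx⟩ := h.exact.le (LinearMap.mem_ker.2 (congrArg Subtype.val hy))
        exact ⟨⟨x, h.mem_of_map_mem x (hx ▸ y.2)⟩, Subtype.ext hx⟩)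
    (fun x hx => (mem_smul_iff_coe_mem _ _ _).2
      (h.pure x x.2 ((mem_smul_iff_coe_mem _ _ _).1 hx)))
    (P.toSyz_surjective n) (L.toSyz_surjective n) (Q.toSyz_surjective n)
    (P.ker_toSyz n) (L.ker_toSyz n) (Q.ker_toSyz n)
  exact ⟨φ', ψ', h', LinearMap.ext fun x => congrArg Subtype.val (LinearMap.congr_fun h₁ x),
    LinearMap.ext fun y => congrArg Subtype.val (LinearMap.congr_fun h₂ y)⟩

end Lifting

theorem minimalHorseshoe_of_map_jSMul {R : Type} [Ring R] {J : Ideal R} (hJ : J = jacobsonRad R)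
    {δ : ℕ → ℕ} {K M N : Type} [AddCommGroup K] [Module R K] [AddCommGroup M] [Module R M]
    [AddCommGroup N] [Module R N] {f : K →ₗ[R] M} {g : M →ₗ[R] N}
    (hf : Function.Injective f) (hg : Function.Surjective g)
    (hfg : LinearMap.range f = LinearMap.ker g)
    (hK : IsQuasiDeltaKoszul J δ K) (hM : IsQuasiDeltaKoszul J δ M)
    (hN : IsQuasiDeltaKoszul J δ N)
    (h : Submodule.map f (jSMul J (⊤ : Submodule R K)) =
      LinearMap.range f ⊓ jSMul J (⊤ : Submodule R M)) : MinimalHorseshoe J f g := by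
  obtain ⟨P, hP⟩ := hK
  obtain ⟨L, hL⟩ := hM
  obtain ⟨Q, -⟩ := hN
  have hpure : ∀ x, f x ∈ J • (⊤ : Submodule R M) → x ∈ J • (⊤ : Submodule R K) := by
    intro x hx
    rw [jSMul_eq_smul, jSMul_eq_smul] at h
    obtain ⟨y, hy, hyx⟩ := h.ge ⟨LinearMap.mem_range_self f x, hx⟩
    exact hf hyx ▸ hy
  obtain ⟨φ₀, ψ₀, h₀, hφ₀, hψ₀⟩ := exists_syzygyExact_of_covers (P := P) (L := L) (Q := Q)
    hJ 0 (hP 0).2 (hL 0).1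
    (P.minimal0.trans_eq (jSMul_eq_smul _ _)) (L.minimal0.trans_eq (jSMul_eq_smul _ _))
    (Q.minimal0.trans_eq (jSMul_eq_smul _ _)) hf hg hfg hpure
    P.aug_surj L.aug_surj Q.aug_surj rfl rfl rfl
  have step : ∀ n (s : {s : (P.obj n →ₗ[R] L.obj n) × (L.obj n →ₗ[R] Q.obj n) //
      SyzygyExact P L Q n s.1 s.2}),
      ∃ s' : {s : (P.obj (n + 1) →ₗ[R] L.obj (n + 1)) × (L.obj (n + 1) →ₗ[R] Q.obj (n + 1)) //
        SyzygyExact P L Q (n + 1) s.1 s.2},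
        L.d n ∘ₗ s'.1.1 = s.1.1 ∘ₗ P.d n ∧ Q.d n ∘ₗ s'.1.2 = s.1.2 ∘ₗ L.d n := by
    rintro n ⟨⟨φ, ψ⟩, hs⟩
    obtain ⟨φ', ψ', hs', h₁, h₂⟩ := hs.exists_succ hJ (hP (n + 1)).2 (hL (n + 1)).1
    exact ⟨⟨(φ', ψ'), hs'⟩, h₁, h₂⟩
  choose next hnext using step
  let s : ∀ n, {s : (P.obj n →ₗ[R] L.obj n) × (L.obj n →ₗ[R] Q.obj n) //
      SyzygyExact P L Q n s.1 s.2} := fun n => Nat.rec ⟨(φ₀, ψ₀), h₀⟩ next n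
  exact ⟨P, L, Q, fun n => (s n).1.1, fun n => (s n).1.2, hφ₀, hψ₀,
    fun n => (hnext n (s n)).1, fun n => (hnext n (s n)).2, fun n => (s n).2.injective,
    fun n => (s n).2.surjective, fun n => (s n).2.exact⟩

theorem MinimalHorseshoe.map_jSMul {R : Type} [Ring R] {J : Ideal R}
    {K M N : Type} [AddCommGroup K] [Module R K] [AddCommGroup M] [Module R M]
    [AddCommGroup N] [Module R N] {f : K →ₗ[R] M} {g : M →ₗ[R] N}
    (h : MinimalHorseshoe J f g) :
    Submodule.map f (jSMul J (⊤ : Submodule R K)) =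
      LinearMap.range f ⊓ jSMul J (⊤ : Submodule R M) := by
  obtain ⟨P, L, Q, φ, ψ, h₁, -, -, -, hφ, hψ, hker⟩ := h
  have := Q.proj 0
  have hsplit : ∃ ρ : L.obj 0 →ₗ[R] P.obj 0, ρ ∘ₗ φ 0 = LinearMap.id :=
    (((LinearMap.exact_iff.2 (hker 0)).split_tfae' (f := φ 0) (g := ψ 0)).out 0 1 :
        (_ ∧ ∃ l, ψ 0 ∘ₗ l = LinearMap.id) ↔ (_ ∧ ∃ l, l ∘ₗ φ 0 = LinearMap.id)).1
      ⟨hφ 0, Module.projective_lifting_property (ψ 0) LinearMap.id (hψ 0)⟩ |>.2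
  obtain ⟨ρ, hρ⟩ := hsplit
  simp only [jSMul_eq_smul]
  refine le_antisymm (le_inf (LinearMap.map_le_range) ?_) ?_
  · rintro _ ⟨x, hx, rfl⟩
    exact map_mem_smul_top J f hx
  · rintro _ ⟨⟨x, rfl⟩, hx⟩
    refine ⟨x, ?_, rfl⟩
    obtain ⟨w, rfl⟩ := P.aug_surj x
    obtain ⟨y, hy, hyw⟩ := exists_mem_smul_top_of_surjective J L.aug_surj hx
    have hφw : L.aug (φ 0 w) = f (P.aug w) := LinearMap.congr_fun h₁ w
    have hsub : φ 0 w - y ∈ J • (⊤ : Submodule R (L.obj 0)) :=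
      (L.minimal0.trans_eq (jSMul_eq_smul _ _)) (by
        rw [LinearMap.mem_ker, map_sub, hφw, hyw, sub_self])
    have hw := map_mem_smul_top J ρ (add_mem hsub hy)
    rw [sub_add_cancel, show ρ (φ 0 w) = w from LinearMap.congr_fun hρ w] at hw
    exact map_mem_smul_top J P.aug hw

/-- Corollary B(3): the quasi-piecewise-Koszul case, where
`δ(n) = (n - r)d/p + r` for `n ≡ r (mod p)`, `0 ≤ r < p`. -/
theorem quasiPiecewiseKoszul_jsmul_iff_minimalHorseshoe
    (d p : ℕ) (hp : 2 ≤ p) (hpd : p ≤ d)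
    {k : Type} [Field k] {R : Type} [Ring R] [Algebra k R] (ε : R →ₐ[k] k)
    [IsNoetherianRing R] (hsp : Semiperfect R) (J : Ideal R)
    (hJ : J = jacobsonRad R)
    (δ : ℕ → ℕ)
    (hδ : ∀ n, δ n = (n - n % p) * d / p + n % p)
    {K M N : Type} [AddCommGroup K] [Module R K] [AddCommGroup M] [Module R M]
    [AddCommGroup N] [Module R N]
    [Module.Finite R K] [Module.Finite R M] [Module.Finite R N]
    (f : K →ₗ[R] M) (g : M →ₗ[R] N)
    (hf : Function.Injective f) (hg : Function.Surjective g)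
    (hfg : LinearMap.range f = LinearMap.ker g)
    (hK : IsQuasiDeltaKoszul J δ K) (hM : IsQuasiDeltaKoszul J δ M)
    (hN : IsQuasiDeltaKoszul J δ N) :
    Submodule.map f (jSMul J (⊤ : Submodule R K)) =
      LinearMap.range f ⊓ jSMul J (⊤ : Submodule R M) ↔
    MinimalHorseshoe J f g := by
  exact ⟨minimalHorseshoe_of_map_jSMul hJ hf hg hfg hK hM hN, MinimalHorseshoe.map_jSMul⟩
end

section
/- Let R be an augmented Noetherian semiperfect algebra with Jacobson radical J and let ξ : 0 → K → M → N → 0 be a short exact sequence of finitely generated R-modules for which the minimal Horseshoe Lemma holds. If M is a quasi-Koszul module, then K is a quasi-Koszul module. -/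
section JSMul

variable {R : Type} [Ring R] {M N : Type} [AddCommGroup M] [Module R M]
  [AddCommGroup N] [Module R N]

theorem jSMul_mono (I : Ideal R) {S T : Submodule R M} (h : S ≤ T) :
    jSMul I S ≤ jSMul I T :=
  Submodule.span_mono fun _ ⟨r, hr, k, hk, hx⟩ => ⟨r, hr, k, h hk, hx⟩

theorem jSMul_le (I : Ideal R) (S : Submodule R M) : jSMul I S ≤ S :=
  Submodule.span_le.2 fun _ ⟨r, _, _, hk, hx⟩ => hx ▸ S.smul_mem r hk

theorem map_jSMul (I : Ideal R) (S : Submodule R M) (f : M →ₗ[R] N) :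
    (jSMul I S).map f = jSMul I (S.map f) := by
  unfold jSMul
  rw [Submodule.map_span]
  congr 1
  ext y
  constructor
  · rintro ⟨_, ⟨r, hr, k, hk, rfl⟩, rfl⟩
    exact ⟨r, hr, f k, Submodule.mem_map_of_mem hk, f.map_smul r k⟩
  · rintro ⟨r, hr, _, ⟨k, hk, rfl⟩, rfl⟩
    exact ⟨r • k, ⟨r, hr, k, hk, rfl⟩, f.map_smul r k⟩

theorem map_jPowSMul_top_le (I : Ideal R) (f : M →ₗ[R] N) (n : ℕ) :
    (jPowSMul I n ⊤).map f ≤ jPowSMul I n ⊤ := by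
  induction n with
  | zero => exact le_top
  | succ n ih => exact (map_jSMul I _ f).trans_le (jSMul_mono I ih)

theorem map_mem_jSMul_top (I : Ideal R) (f : M →ₗ[R] N) {x : M}
    (hx : x ∈ jSMul I (⊤ : Submodule R M)) : f x ∈ jSMul I (⊤ : Submodule R N) :=
  map_jPowSMul_top_le I f 1 (Submodule.mem_map_of_mem hx)

end JSMul

/-- A map from a projective module lifts through any map whose range contains its range. -/
theorem Module.Projective.exists_comp_eq_of_range_le {R : Type} [Ring R] {P M N : Type}
    [AddCommGroup P] [Module R P] [AddCommGroup M] [Module R M] [AddCommGroup N] [Module R N]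
    (hP : Module.Projective R P) (f : M →ₗ[R] N) (g : P →ₗ[R] N)
    (h : LinearMap.range g ≤ LinearMap.range f) : ∃ l : P →ₗ[R] M, f ∘ₗ l = g := by
  obtain ⟨l, hl⟩ := Module.projective_lifting_property f.rangeRestrict
    (g.codRestrict (LinearMap.range f) fun x => h ⟨x, rfl⟩) f.surjective_rangeRestrict
  exact ⟨l, LinearMap.ext fun x => congrArg Subtype.val (LinearMap.congr_fun hl x)⟩

namespace MinProjRes

variable {R : Type} [Ring R] {J : Ideal R} {X Y : Type} [AddCommGroup X] [Module R X]
  [AddCommGroup Y] [Module R Y]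

theorem syz_eq_range (P : MinProjRes R J X) (n : ℕ) : P.syz n = LinearMap.range (P.d n) := by
  cases n with
  | zero => exact P.exact0.symm
  | succ n => exact (P.exact n).symm

theorem syz_le (P : MinProjRes R J X) (n : ℕ) : P.syz n ≤ jSMul J ⊤ := by
  cases n with
  | zero => exact P.minimal0
  | succ n => exact P.minimal n

theorem d_mem (P : MinProjRes R J X) (n : ℕ) (x : P.obj (n + 1)) : P.d n x ∈ jSMul J ⊤ :=
  P.syz_le n (P.syz_eq_range n ▸ ⟨x, rfl⟩)

theorem aug_d (P : MinProjRes R J X) (x : P.obj 1) : P.aug (P.d 0 x) = 0 :=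
  P.exact0.le ⟨x, rfl⟩

theorem d_d (P : MinProjRes R J X) (n : ℕ) (x : P.obj (n + 2)) : P.d n (P.d (n + 1) x) = 0 :=
  (P.exact n).le ⟨x, rfl⟩

theorem jSMul_syz_le (P : MinProjRes R J X) (n : ℕ) :
    jSMul J (P.syz n) ≤ P.syz n ⊓ jPowSMul J 2 ⊤ :=
  le_inf (jSMul_le J _) (jSMul_mono J (P.syz_le n))

/-- The comparison theorem: a module homomorphism lifts to a chain map. -/
theorem exists_lift (P : MinProjRes R J X) (A : MinProjRes R J Y) (f : X →ₗ[R] Y) :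
    ∃ α : ∀ n, P.obj n →ₗ[R] A.obj n, A.aug ∘ₗ α 0 = f ∘ₗ P.aug ∧
      ∀ n, A.d n ∘ₗ α (n + 1) = α n ∘ₗ P.d n := by
  obtain ⟨α₀, h₀⟩ := (P.proj 0).exists_comp_eq_of_range_le A.aug (f ∘ₗ P.aug)
    (by rw [LinearMap.range_eq_top.2 A.aug_surj]; exact le_top)
  obtain ⟨α₁, h₁⟩ := (P.proj 1).exists_comp_eq_of_range_le (A.d 0) (α₀ ∘ₗ P.d 0) (by
    rw [A.exact0]
    rintro _ ⟨x, rfl⟩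
    have := LinearMap.congr_fun h₀ (P.d 0 x)
    simpa [P.aug_d] using this)
  let C (n : ℕ) : Type := {p : (P.obj n →ₗ[R] A.obj n) × (P.obj (n + 1) →ₗ[R] A.obj (n + 1)) //
    A.d n ∘ₗ p.2 = p.1 ∘ₗ P.d n}
  have step (n : ℕ) (p : C n) : ∃ q : C (n + 1), q.1.1 = p.1.2 := by
    obtain ⟨l, hl⟩ := (P.proj (n + 2)).exists_comp_eq_of_range_le (A.d (n + 1))
      (p.1.2 ∘ₗ P.d (n + 1)) (by
        rw [A.exact n]
        rintro _ ⟨x, rfl⟩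
        have := LinearMap.congr_fun p.2 (P.d (n + 1) x)
        simpa [P.d_d] using this)
    exact ⟨⟨(p.1.2, l), hl⟩, rfl⟩
  choose next hnext using step
  let c (n : ℕ) : C n := Nat.rec ⟨(α₀, α₁), h₁⟩ next n
  refine ⟨fun n => (c n).1.1, h₀, fun n => ?_⟩
  have h : (c (n + 1)).1.1 = (c n).1.2 := hnext n (c n)
  change A.d n ∘ₗ (c (n + 1)).1.1 = _
  rw [h]
  exact (c n).2

/-- A chain endomorphism of a minimal resolution that lifts zero is zero modulo the radical. -/
theorem mem_jSMul_of_lift_zero (P : MinProjRes R J X) (γ : ∀ n, P.obj n →ₗ[R] P.obj n)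
    (h₀ : P.aug ∘ₗ γ 0 = 0) (h : ∀ n, P.d n ∘ₗ γ (n + 1) = γ n ∘ₗ P.d n) (n : ℕ)
    (x : P.obj (n + 1)) : γ (n + 1) x ∈ jSMul J ⊤ := by
  have key : ∃ s : P.obj n →ₗ[R] P.obj (n + 1),
      P.d n ∘ₗ (γ (n + 1) - s ∘ₗ P.d n) = 0 := by
    clear x
    induction n with
    | zero =>
      obtain ⟨s, hs⟩ := (P.proj 0).exists_comp_eq_of_range_le (P.d 0) (γ 0) (by
        rw [P.exact0]
        rintro _ ⟨x, rfl⟩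
        exact LinearMap.congr_fun h₀ x)
      refine ⟨s, ?_⟩
      rw [LinearMap.comp_sub, h, ← LinearMap.comp_assoc, hs, sub_self]
    | succ n ih =>
      obtain ⟨s, hs⟩ := ih
      obtain ⟨t, ht⟩ := (P.proj (n + 1)).exists_comp_eq_of_range_le (P.d (n + 1))
        (γ (n + 1) - s ∘ₗ P.d n) (by
          rw [P.exact n]
          rintro _ ⟨x, rfl⟩
          exact LinearMap.congr_fun hs x)
      refine ⟨t, ?_⟩
      rw [LinearMap.comp_sub, h, ← LinearMap.comp_assoc, ht]
      ext x
      simp [P.d_d]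
  obtain ⟨s, hs⟩ := key
  have h₁ : γ (n + 1) x - s (P.d n x) ∈ jSMul J (⊤ : Submodule R (P.obj (n + 1))) :=
    P.minimal n (LinearMap.congr_fun hs x)
  simpa using add_mem h₁ (map_mem_jSMul_top J s (P.d_mem n x))

/-- A chain map between minimal resolutions of a module that lifts the identity reflects
membership in the radical. -/
theorem mem_jSMul_of_lift_id (P A : MinProjRes R J X) (α : ∀ n, P.obj n →ₗ[R] A.obj n)
    (h₀ : A.aug ∘ₗ α 0 = P.aug) (h : ∀ n, A.d n ∘ₗ α (n + 1) = α n ∘ₗ P.d n) (n : ℕ)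
    (x : P.obj (n + 1)) (hx : α (n + 1) x ∈ jSMul J ⊤) : x ∈ jSMul J ⊤ := by
  obtain ⟨β, hβ₀, hβ⟩ := A.exists_lift P LinearMap.id
  have hγ := P.mem_jSMul_of_lift_zero (fun n => β n ∘ₗ α n - LinearMap.id)
    (by rw [LinearMap.comp_sub, ← LinearMap.comp_assoc, hβ₀, LinearMap.id_comp, h₀,
      LinearMap.comp_id, sub_self])
    (fun n => by rw [LinearMap.comp_sub, ← LinearMap.comp_assoc, hβ, LinearMap.comp_assoc, h,
      LinearMap.sub_comp, LinearMap.comp_assoc, LinearMap.comp_id, LinearMap.id_comp]) n x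
  simpa using sub_mem (map_mem_jSMul_top J (β (n + 1)) hx) hγ

/-- The quasi-Koszul condition descends along chain maps that reflect membership in the
radical. -/
theorem jSMul_syz_eq_of_reflects (P : MinProjRes R J X) (A : MinProjRes R J Y) (n : ℕ)
    (θ : P.obj n →ₗ[R] A.obj n) (θ' : P.obj (n + 1) →ₗ[R] A.obj (n + 1))
    (h : A.d n ∘ₗ θ' = θ ∘ₗ P.d n) (hθ : ∀ x, θ' x ∈ jSMul J ⊤ → x ∈ jSMul J ⊤)
    (hA : jSMul J (A.syz n) = A.syz n ⊓ jPowSMul J 2 ⊤) :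
    jSMul J (P.syz n) = P.syz n ⊓ jPowSMul J 2 ⊤ := by
  refine le_antisymm (P.jSMul_syz_le n) ?_
  rintro x ⟨hx, hx₂⟩
  rw [SetLike.mem_coe, P.syz_eq_range n] at hx
  obtain ⟨p, rfl⟩ := hx
  have hp : A.d n (θ' p) = θ (P.d n p) := LinearMap.congr_fun h p
  have hmem : A.d n (θ' p) ∈ jSMul J (A.syz n) := by
    rw [hA]
    refine ⟨?_, ?_⟩
    · rw [SetLike.mem_coe, A.syz_eq_range n]
      exact ⟨_, rfl⟩
    · rw [hp]
      exact map_jPowSMul_top_le J θ 2 (Submodule.mem_map_of_mem hx₂)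
  rw [A.syz_eq_range n, LinearMap.range_eq_map, ← map_jSMul] at hmem
  obtain ⟨a, ha, hap⟩ := hmem
  have hsub : θ' p - a ∈ jSMul J (⊤ : Submodule R (A.obj (n + 1))) :=
    A.minimal n (by rw [LinearMap.mem_ker, map_sub, hap, sub_self])
  have hθp : θ' p ∈ jSMul J (⊤ : Submodule R (A.obj (n + 1))) := by
    simpa using add_mem hsub ha
  rw [P.syz_eq_range n, LinearMap.range_eq_map, ← map_jSMul]
  exact Submodule.mem_map_of_mem (hθ p hθp)

end MinProjRes

/-- Theorem D(1): if the minimal Horseshoe Lemma holds for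
`0 → K → M → N → 0` and `M` is quasi-Koszul, then so is `K`. -/
theorem quasiKoszul_of_minimalHorseshoe
    {k : Type} [Field k] {R : Type} [Ring R] [Algebra k R] (ε : R →ₐ[k] k)
    [IsNoetherianRing R] (hsp : Semiperfect R) (J : Ideal R)
    (hJ : J = jacobsonRad R)
    {K M N : Type} [AddCommGroup K] [Module R K] [AddCommGroup M] [Module R M]
    [AddCommGroup N] [Module R N]
    [Module.Finite R K] [Module.Finite R M] [Module.Finite R N]
    (f : K →ₗ[R] M) (g : M →ₗ[R] N)
    (hf : Function.Injective f) (hg : Function.Surjective g)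
    (hfg : LinearMap.range f = LinearMap.ker g)
    (hMHL : MinimalHorseshoe J f g)
    (hM : IsQuasiKoszul J M) :
    IsQuasiKoszul J K := by
  obtain ⟨P, L, Q, φ, ψ, -, -, hφ, -, hinj, hsurj, hker⟩ := hMHL
  obtain ⟨A, hA⟩ := hM
  obtain ⟨α, hα₀, hα⟩ := L.exists_lift A LinearMap.id
  rw [LinearMap.id_comp] at hα₀
  refine ⟨P, fun n => ?_⟩
  have hL := L.jSMul_syz_eq_of_reflects A n (α n) (α (n + 1)) (hα n)
    (L.mem_jSMul_of_lift_id A α hα₀ hα n) (hA n)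
  refine P.jSMul_syz_eq_of_reflects L n (φ n) (φ (n + 1)) (hφ n) (fun x hx => ?_) hL
  have := Q.proj (n + 1)
  obtain ⟨s, hs⟩ := Module.projective_lifting_property (ψ (n + 1)) LinearMap.id (hsurj (n + 1))
  have hexact : Function.Exact (φ (n + 1)) (ψ (n + 1)) := LinearMap.exact_iff.2 (hker (n + 1))
  have hsplit : Function.Injective (φ (n + 1)) ∧ ∃ s, ψ (n + 1) ∘ₗ s = LinearMap.id :=
    ⟨hinj (n + 1), s, hs⟩
  obtain ⟨-, ρ, hρ⟩ := (hexact.split_tfae'.out 0 1).1 hsplit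
  have hx' := map_mem_jSMul_top J ρ hx
  rwa [← LinearMap.comp_apply, hρ, LinearMap.id_apply] at hx'
end
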